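/- arXiv:1909.00838 — 2 statements merged into one kernel-verified Lean document; each statement's English description precedes it below -/
import Mathlib

section
/- Let (K, l, α) be a bosonic Gaussian channel with det K ≠ 0 such that the matrix -Kᵀ·J·K·J has no negative real eigenvalues. Then there exist real symplectic matrices S₁ and S₂ (Sᵢ·J·Sᵢᵀ = J), vectors h₁, h₂ ∈ ℝ^{2n}, a real skew-symmetric matrix A (Aᵀ = -A), and a real diagonal matrix Λ such that S₁·K·S₂ = A, S₂ᵀ·Kᵀ·h₁ + S₂ᵀ·l + h₂ = 0, and S₂ᵀ·α·S₂ = Λ. Equivalently, the channel (K, l, α) is transformed by inhomogeneous symplectic transformations into the channel (A, 0, Λ). -/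
open Matrix
open scoped ComplexOrder

/-- The standard symplectic form matrix `J = [[0, -I_n], [I_n, 0]]`. -/
def symplJ (n : ℕ) : Matrix (Fin n ⊕ Fin n) (Fin n ⊕ Fin n) ℝ :=
  Matrix.fromBlocks 0 (-1) 1 0

/-- The block diagonal matrix `D = [[I_n, 0], [0, -I_n]]`. -/
def Dmat (n : ℕ) : Matrix (Fin n ⊕ Fin n) (Fin n ⊕ Fin n) ℝ :=
  Matrix.fromBlocks 1 0 0 (-1)

/-- The triple `(K, l, α)` is a bosonic Gaussian channel: `α` is symmetric and the complex
matrix `α - (i/2)(J - Kᵀ·J·K)` is positive semidefinite. -/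
def IsBosonicGaussianChannel (n : ℕ) (K : Matrix (Fin n ⊕ Fin n) (Fin n ⊕ Fin n) ℝ)
    (l : (Fin n ⊕ Fin n) → ℝ) (α : Matrix (Fin n ⊕ Fin n) (Fin n ⊕ Fin n) ℝ) : Prop :=
  αᵀ = α ∧
    (α.map (Complex.ofReal) -
      (Complex.I / 2) • ((symplJ n).map Complex.ofReal -
        (Kᵀ * symplJ n * K).map Complex.ofReal)).PosSemidef

open Polynomial in
/-- A real irreducible polynomial without roots in `(-∞, 0]` divides some
`p ^ 2 - X`. -/
theorem Irreducible.exists_dvd_sq_sub_X {q : ℝ[X]} (hq : Irreducible q)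
    (h : ∀ t ≤ 0, q.eval t ≠ 0) : ∃ p : ℝ[X], q ∣ p ^ 2 - X := by
  by_cases hr : ∃ t, q.IsRoot t
  · obtain ⟨t, ht⟩ := hr
    have ht0 : 0 ≤ t := by
      by_contra! hlt
      exact h t hlt.le ht
    have hass : Associated (X - C t) q :=
      (Polynomial.irreducible_X_sub_C t).associated_of_dvd hq (dvd_iff_isRoot.2 ht)
    refine ⟨C √t, hass.symm.dvd.trans ?_⟩
    rw [dvd_iff_isRoot]
    simp [Real.sq_sqrt ht0]
  · push Not at hr
    obtain ⟨a, b, c, habc⟩ : ∃ a b c : ℝ, q = C a * X ^ 2 + C b * X + C c :=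
      ⟨_, _, _, Polynomial.eq_quadratic_of_degree_le_two hq.degree_le_two⟩
    have hev (t : ℝ) : q.eval t = a * t ^ 2 + b * t + c := by simp [habc]
    have hne (t : ℝ) : a * t ^ 2 + b * t + c ≠ 0 := by rw [← hev]; exact hr t
    have ha : a ≠ 0 := by
      rintro rfl
      by_cases hb : b = 0
      · subst hb
        refine hq.not_isUnit ?_
        have hc : c ≠ 0 := by simpa using hne 0
        simpa [habc] using hc
      · exact hne (-c / b) (by field_simp; ring)
    have hd : b ^ 2 < 4 * a * c := by
      by_contra! hle
      set s := √(b ^ 2 - 4 * a * c)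
      have hs : s ^ 2 = b ^ 2 - 4 * a * c := Real.sq_sqrt (by linarith)
      refine hne ((-b + s) / (2 * a)) ?_
      field_simp
      linear_combination hs
    set b' := b / a with hb'
    set c' := c / a with hc'
    have hd' : b' ^ 2 < 4 * c' := by
      have : b' ^ 2 - 4 * c' = (b ^ 2 - 4 * a * c) / a ^ 2 := by rw [hb', hc']; field_simp
      have h2 : (b ^ 2 - 4 * a * c) / a ^ 2 < 0 := div_neg_of_neg_of_pos (by linarith) (by positivity)
      linarith
    have hc0 : 0 < c' := by nlinarith [sq_nonneg b']
    set w := √c'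
    have hw : w ^ 2 = c' := Real.sq_sqrt hc0.le
    have hw0 : 0 < w := Real.sqrt_pos.2 hc0
    have hpos : 0 < 2 * w - b' := by
      nlinarith [abs_lt_of_sq_lt_sq (a := b') (b := 2 * w) (by nlinarith) (by positivity),
        le_abs_self b', abs_lt.1 (abs_lt_of_sq_lt_sq (a := b') (b := 2 * w) (by nlinarith) (by positivity))]
    set u := √((2 * w - b')⁻¹)
    have hu : u ^ 2 * (2 * w - b') = 1 := by
      rw [Real.sq_sqrt (by positivity)]; field_simp
    refine ⟨C u * X + C (u * w), C (u ^ 2 / a), ?_⟩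
    rw [habc]
    have hb2 : b = b' * a := by rw [hb']; field_simp
    have hc2 : c = w ^ 2 * a := by rw [hw, hc']; field_simp
    have e1 : u ^ 2 / a * a = u ^ 2 := by field_simp
    have e2 : u ^ 2 / a * b = 2 * u ^ 2 * w - 1 := by rw [hb2]; field_simp; linear_combination -hu
    have e3 : u ^ 2 / a * c = u ^ 2 * w ^ 2 := by rw [hc2]; field_simp
    have E1 := congrArg C e1
    have E2 := congrArg C e2
    have E3 := congrArg C e3
    simp only [map_mul, map_pow, map_sub, map_ofNat, map_one] at E1 E2 E3 ⊢
    linear_combination -X ^ 2 * E1 - X * E2 - E3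

open Polynomial in
theorem Irreducible.exists_pow_dvd_sq_sub_X {q : ℝ[X]} (hq : Irreducible q)
    (h : ∀ t ≤ 0, q.eval t ≠ 0) (k : ℕ) : ∃ p : ℝ[X], q ^ (k + 1) ∣ p ^ 2 - X := by
  induction k with
  | zero => simpa using hq.exists_dvd_sq_sub_X h
  | succ k ih =>
    obtain ⟨r, m, hm⟩ := ih
    have hX : ¬ q ∣ X := fun hdvd => by
      obtain ⟨s, hs⟩ := hdvd
      have := (irreducible_X (R := ℝ)).isUnit_or_isUnit hs
      rcases this with hu | hu
      · exact hq.not_isUnit hu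
      · have := congrArg (eval 0) hs
        simp only [eval_X, eval_mul, zero_eq_mul] at this
        rcases this with h0 | h0
        · exact h 0 le_rfl h0
        · exact (hu.map (evalRingHom 0)).ne_zero (by simpa using h0)
    have hqr : ¬ q ∣ r := fun hdvd => hX <| by
      have h1 : X = r ^ 2 - q ^ (k + 1) * m := by rw [← hm]; ring
      rw [h1]
      exact dvd_sub (hdvd.trans (dvd_pow_self r two_ne_zero))
        ((dvd_pow_self q k.succ_ne_zero).trans (dvd_mul_right _ _))
    obtain ⟨a, b, hab⟩ : IsCoprime (q ^ (k + 1)) r :=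
      ((hq.coprime_iff_not_dvd).2 hqr).pow_left
    have h2 : (C (1 / 2) : ℝ[X]) * 2 = 1 := by
      rw [← map_ofNat C 2, ← map_mul]; norm_num
    refine ⟨r - C (1 / 2) * b * (q ^ (k + 1) * m),
      q ^ k * (m * a + (C (1 / 2) * b * m) ^ 2), ?_⟩
    linear_combination (1 : ℝ[X]) * hm - (b * r * (q ^ (k + 1) * m)) * h2 - (q ^ (k + 1) * m) * hab

open Polynomial in
/-- A real polynomial without roots in `(-∞, 0]` divides `p ^ 2 - X` for some `p`. -/
theorem Polynomial.exists_dvd_sq_sub_X (q : ℝ[X])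
    (h : ∀ t ≤ 0, q.eval t ≠ 0) : ∃ p : ℝ[X], q ∣ p ^ 2 - X := by
  induction q using UniqueFactorizationMonoid.induction_on_coprime with
  | h0 => exact absurd (by simp) (h 0 le_rfl)
  | h1 hx => exact ⟨0, hx.dvd⟩
  | hpr i hp =>
    rcases i with _ | i
    · exact ⟨0, by simp⟩
    · exact hp.irreducible.exists_pow_dvd_sq_sub_X (fun t ht h0 => h t ht (by simp [h0])) i
  | @hcp x y hxy hx hy =>
    obtain ⟨p, hp⟩ := hx fun t ht h0 => h t ht (by simp [h0])
    obtain ⟨r, hr⟩ := hy fun t ht h0 => h t ht (by simp [h0])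
    have hco : IsCoprime x y := hxy.isCoprime
    obtain ⟨a, b, hab⟩ := id hco
    refine ⟨p * (b * y) + r * (a * x), hco.mul_dvd ?_ ?_⟩
    · obtain ⟨m, hm⟩ := hp
      refine ⟨m + a * (r - p) * (p + (p * (b * y) + r * (a * x))), ?_⟩
      linear_combination hm + p * (p + (p * (b * y) + r * (a * x))) * hab
    · obtain ⟨m, hm⟩ := hr
      refine ⟨m + b * (p - r) * (r + (p * (b * y) + r * (a * x))), ?_⟩
      linear_combination hm + r * (r + (p * (b * y) + r * (a * x))) * hab

/-- A real square matrix without eigenvalues in `(-∞, 0]` has a square root that is a polynomial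
in the matrix. -/
theorem Matrix.exists_aeval_sq_eq {ι : Type*} [Fintype ι] [DecidableEq ι] (W : Matrix ι ι ℝ)
    (h : ∀ t ≤ 0, t ∉ spectrum ℝ W) :
    ∃ p : Polynomial ℝ, Polynomial.aeval W p ^ 2 = W := by
  obtain ⟨p, m, hm⟩ := W.charpoly.exists_dvd_sq_sub_X fun t ht h0 =>
    h t ht (Matrix.mem_spectrum_of_isRoot_charpoly h0)
  refine ⟨p, ?_⟩
  have := congrArg (Polynomial.aeval W) hm
  simpa [Matrix.aeval_self_charpoly, sub_eq_zero] using this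

section Williamson

variable {V : Type*} [AddCommGroup V] [Module ℝ V]

theorem LinearMap.apply_eq_zero_of_nonneg_of_apply_self_eq_zero {Q : V →ₗ[ℝ] V →ₗ[ℝ] ℝ}
    (hsymm : ∀ x y, Q x y = Q y x) (hnonneg : ∀ x, 0 ≤ Q x x) {f : V} (hf : Q f f = 0) :
    Q f = 0 := by
  ext v
  by_contra hv
  rw [LinearMap.zero_apply] at hv
  have h := hnonneg (v + (-(Q v v + 1) / (2 * Q f v)) • f)
  simp only [map_add, map_smul, LinearMap.add_apply, LinearMap.smul_apply, smul_eq_mul, hf,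
    hsymm v f] at h
  have h2 : -(Q v v + 1) / (2 * Q f v) * Q f v = -(Q v v + 1) / 2 := by field_simp
  rw [h2] at h
  linarith

/-- An operator that is self-adjoint for an inner product given as a bilinear form has an
eigenvector. -/
theorem LinearMap.exists_eigenvector_of_posDef_of_selfAdjoint [FiniteDimensional ℝ V]
    [Nontrivial V] {Q : V →ₗ[ℝ] V →ₗ[ℝ] ℝ} (hsymm : ∀ x y, Q x y = Q y x)
    (hnonneg : ∀ x, 0 ≤ Q x x) (hdef : ∀ x, Q x x = 0 → x = 0) {T : V →ₗ[ℝ] V}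
    (hT : ∀ x y, Q (T x) y = Q x (T y)) : ∃ (c : ℝ) (v : V), v ≠ 0 ∧ T v = c • v := by
  let core : InnerProductSpace.Core ℝ V :=
    { inner := fun x y => Q x y
      conj_inner_symm := fun x y => hsymm y x
      re_inner_nonneg := hnonneg
      add_left := fun x y z => by simp
      smul_left := fun x y r => by simp
      definite := hdef }
  let _ : NormedAddCommGroup V := core.toNormedAddCommGroup
  let _ : InnerProductSpace ℝ V := InnerProductSpace.ofCore core.toCore
  have hTs : T.IsSymmetric := hT
  obtain ⟨v, hv⟩ := hTs.hasEigenvalue_iSup_of_finiteDimensional.exists_hasEigenvector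
  exact ⟨_, v, hv.2, hv.apply_eq_smul⟩

/-- A positive semidefinite form on a symplectic space admits a hyperbolic pair whose span splits
off orthogonally for both forms. -/
theorem LinearMap.exists_hyperbolic_pair [FiniteDimensional ℝ V] [Nontrivial V]
    {ω Q : V →ₗ[ℝ] V →ₗ[ℝ] ℝ} (halt : ∀ x, ω x x = 0) (hnd : ∀ x, ω x = 0 → x = 0)
    (hsymm : ∀ x y, Q x y = Q y x) (hnonneg : ∀ x, 0 ≤ Q x x) :
    ∃ (e f : V) (c d : ℝ), ω e f = 1 ∧ Q e = c • ω f ∧ Q f = d • ω e := by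
  have hskew (x y : V) : ω x y = -ω y x := by
    have := halt (x + y)
    simp only [map_add, LinearMap.add_apply, halt] at this
    linarith
  have hrange (φ : V →ₗ[ℝ] ℝ) (hφ : ∀ x, Q x = 0 → φ x = 0) : ∃ f, Q f = φ := by
    have hflip : Q.flip = Q := by
      ext x y
      exact hsymm y x
    have : φ ∈ Q.ker.dualAnnihilator := (Submodule.mem_dualAnnihilator φ).2 hφ
    rwa [LinearMap.dualAnnihilator_ker_eq_range_flip, hflip] at this
  by_cases hdef : ∀ x, Q x x = 0 → x = 0
  · have hQinj : Function.Injective Q := by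
      refine (injective_iff_map_eq_zero Q).2 fun x hx => hdef x ?_
      simp [hx]
    have hsurj (φ : V →ₗ[ℝ] ℝ) : ∃ f, Q f = φ :=
      hrange φ fun x hx => by rw [hQinj (hx.trans (map_zero Q).symm), map_zero]
    let E : V ≃ₗ[ℝ] (V →ₗ[ℝ] ℝ) := LinearEquiv.ofBijective Q ⟨hQinj, hsurj⟩
    let B : V →ₗ[ℝ] V := E.symm.toLinearMap ∘ₗ ω
    have hB (x : V) : Q (B x) = ω x := E.apply_symm_apply (ω x)
    have hBskew (x y : V) : Q (B x) y = -Q x (B y) := by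
      rw [hsymm x, hB, hB, hskew]
    obtain ⟨c, e, he, hc⟩ := LinearMap.exists_eigenvector_of_posDef_of_selfAdjoint
      (T := B ∘ₗ B) hsymm hnonneg hdef fun x y => by
        simp only [LinearMap.comp_apply]
        rw [hBskew, hBskew, neg_neg]
    rw [LinearMap.comp_apply] at hc
    have hBe : B e ≠ 0 := fun h0 => he <| hnd e <| by rw [← hB, h0, map_zero]
    have hpos : 0 < Q (B e) (B e) := (hnonneg _).lt_of_ne fun h0 => hBe (hdef _ h0.symm)
    have hc0 : c ≠ 0 := by
      rintro rfl
      rw [zero_smul] at hc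
      refine hpos.ne' ?_
      rw [hBskew, hc, map_zero, neg_zero]
    set s := Q (B e) (B e) with hs
    refine ⟨e, s⁻¹ • B e, s / c, s⁻¹, ?_, ?_, ?_⟩
    · rw [map_smul, ← hB, smul_eq_mul, inv_mul_cancel₀ hpos.ne']
    · rw [map_smul, ← hB (B e), hc, map_smul, smul_smul, smul_smul]
      have : s / c * s⁻¹ * c = 1 := by field_simp
      rw [this, one_smul]
    · rw [map_smul, hB]
  · push Not at hdef
    obtain ⟨u, hu, hu0⟩ := hdef
    have hQu : Q u = 0 :=
      LinearMap.apply_eq_zero_of_nonneg_of_apply_self_eq_zero hsymm hnonneg hu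
    by_cases hN : ∀ x, Q x = 0 → ω u x = 0
    · obtain ⟨f, hf⟩ := hrange (ω u) hN
      have hs : Q f f ≠ 0 := fun h0 => hu0 <| hnd u <| by
        rw [← hf]
        exact LinearMap.apply_eq_zero_of_nonneg_of_apply_self_eq_zero hsymm hnonneg h0
      refine ⟨u, (Q f f)⁻¹ • f, 0, (Q f f)⁻¹, ?_, ?_, ?_⟩
      · rw [map_smul, ← hf, smul_eq_mul, inv_mul_cancel₀ hs]
      · rw [hQu, zero_smul]
      · rw [map_smul, hf]
    · push Not at hN
      obtain ⟨f, hf, hs⟩ := hN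
      refine ⟨u, (ω u f)⁻¹ • f, 0, 0, ?_, ?_, ?_⟩
      · rw [map_smul, smul_eq_mul, inv_mul_cancel₀ hs]
      · rw [hQu, zero_smul]
      · rw [map_smul, hf, smul_zero, zero_smul]

/-- **Williamson's theorem** for positive semidefinite forms: there is a symplectic basis which is
orthogonal for the given form. -/
theorem LinearMap.exists_symplectic_orthogonal_family (n : ℕ) {V : Type*} [AddCommGroup V]
    [Module ℝ V] [FiniteDimensional ℝ V] (hV : Module.finrank ℝ V = 2 * n)
    (ω Q : V →ₗ[ℝ] V →ₗ[ℝ] ℝ) (halt : ∀ x, ω x x = 0) (hnd : ∀ x, ω x = 0 → x = 0)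
    (hsymm : ∀ x y, Q x y = Q y x) (hnonneg : ∀ x, 0 ≤ Q x x) :
    ∃ e f : Fin n → V, (∀ i j, ω (e i) (e j) = 0) ∧ (∀ i j, ω (f i) (f j) = 0) ∧
      (∀ i j, ω (e i) (f j) = if i = j then 1 else 0) ∧ (∀ i j, Q (e i) (f j) = 0) ∧
      (∀ i j, i ≠ j → Q (e i) (e j) = 0) ∧ (∀ i j, i ≠ j → Q (f i) (f j) = 0) := by
  induction n generalizing V with
  | zero => exact ⟨0, 0, by simp⟩
  | succ n ih =>
    have : Nontrivial V := Module.nontrivial_of_finrank_pos (R := ℝ) (by omega)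
    have hskew (x y : V) : ω x y = -ω y x := by
      have := halt (x + y)
      simp only [map_add, LinearMap.add_apply, halt] at this
      linarith
    obtain ⟨e, f, c, d, hef, hQe, hQf⟩ := LinearMap.exists_hyperbolic_pair halt hnd hsymm hnonneg
    have hfe : ω f e = -1 := by rw [hskew, hef]
    let φ : V →ₗ[ℝ] ℝ × ℝ := (ω e).prod (ω f)
    have hφ : Function.Surjective φ := fun p => ⟨p.1 • f - p.2 • e, by
      ext <;> simp [φ, hef, hfe, halt]⟩
    let W := φ.ker
    have hWe (w : W) : ω e w = 0 := congrArg Prod.fst (LinearMap.mem_ker.1 w.2)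
    have hWf (w : W) : ω f w = 0 := congrArg Prod.snd (LinearMap.mem_ker.1 w.2)
    have hW : Module.finrank ℝ W = 2 * n := by
      have h1 := φ.finrank_range_add_finrank_ker
      rw [LinearMap.range_eq_top.2 hφ, finrank_top, Module.finrank_prod, Module.finrank_self,
        hV] at h1
      change _ + Module.finrank ℝ W = _ at h1
      omega
    obtain ⟨e', f', h1, h2, h3, h4, h5, h6⟩ := ih hW (ω.domRestrict₁₂ W W) (Q.domRestrict₁₂ W W)
      (fun x => halt x) (fun x hx => by
        refine Subtype.ext (hnd _ (LinearMap.ext fun v => ?_))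
        have hv : v - ω e v • f + ω f v • e ∈ W := by
          refine LinearMap.mem_ker.2 (Prod.ext ?_ ?_) <;> simp [φ, hef, hfe, halt]
        have h0 := LinearMap.congr_fun hx ⟨_, hv⟩
        simp only [LinearMap.domRestrict₁₂_apply, map_add, map_sub, map_smul,
          hskew x e, hskew x f, hWe, hWf] at h0
        simpa using h0) (fun x y => hsymm x y) (fun x => hnonneg x)
    simp only [LinearMap.domRestrict₁₂_apply] at h1 h2 h3 h4 h5 h6
    have hWe' (w : W) : ω w e = 0 := by rw [hskew, hWe, neg_zero]
    have hWf' (w : W) : ω w f = 0 := by rw [hskew, hWf, neg_zero]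
    have hQWe (w : W) : Q e w = 0 := by simp [hQe, hWf]
    have hQWf (w : W) : Q f w = 0 := by simp [hQf, hWe]
    have hQWe' (w : W) : Q w e = 0 := by rw [hsymm, hQWe]
    have hQWf' (w : W) : Q w f = 0 := by rw [hsymm, hQWf]
    have hQef : Q e f = 0 := by simp [hQe, halt]
    refine ⟨Fin.cons e fun i => e' i, Fin.cons f fun i => f' i, ?_, ?_, ?_, ?_, ?_, ?_⟩ <;>
      intro i j <;> refine Fin.cases ?_ (fun i => ?_) i <;> refine Fin.cases ?_ (fun j => ?_) j
    all_goals clear hskew hsymm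
    all_goals simp +contextual [*, (Fin.succ_ne_zero _).symm]

end Williamson

/-- **Williamson's theorem**: a real positive semidefinite matrix of even size is diagonalized by
a congruence with a symplectic matrix. -/
theorem Matrix.PosSemidef.exists_symplectic_diagonal {n : ℕ}
    {α : Matrix (Fin n ⊕ Fin n) (Fin n ⊕ Fin n) ℝ} (hα : α.PosSemidef) :
    ∃ S ∈ symplecticGroup (Fin n) ℝ, ∃ d, Sᵀ * α * S = diagonal d := by
  have hdet : (J (Fin n) ℝ)ᵀ.det ≠ 0 := by
    rw [det_transpose]
    exact (isUnit_det_J (Fin n) ℝ).ne_zero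
  have hinj := Matrix.mulVec_injective_iff_isUnit.2 ((Matrix.isUnit_iff_isUnit_det _).2 hdet.isUnit)
  have hvec (M : Matrix (Fin n ⊕ Fin n) (Fin n ⊕ Fin n) ℝ) (x y : Fin n ⊕ Fin n → ℝ) :
      x ⬝ᵥ M *ᵥ y = y ⬝ᵥ Mᵀ *ᵥ x := by
    rw [dotProduct_mulVec, dotProduct_comm, mulVec_transpose]
  have hsymm : αᵀ = α := by simpa using hα.isHermitian.eq
  obtain ⟨e, f, h1, h2, h3, h4, h5, h6⟩ := LinearMap.exists_symplectic_orthogonal_family n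
    (V := Fin n ⊕ Fin n → ℝ) (by simp [two_mul])
    (Matrix.toLinearMap₂' ℝ (J (Fin n) ℝ)ᵀ) (Matrix.toLinearMap₂' ℝ α)
    (fun x => by
      have h := hvec (J (Fin n) ℝ) x x
      rw [J_transpose] at h
      rw [toLinearMap₂'_apply', J_transpose]
      simp only [neg_mulVec, dotProduct_neg] at h ⊢
      linarith)
    (fun x hx => hinj <| by
      change (J (Fin n) ℝ)ᵀ *ᵥ x = (J (Fin n) ℝ)ᵀ *ᵥ 0
      rw [mulVec_zero]
      refine dotProduct_eq_zero _ fun y => ?_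
      have h := LinearMap.congr_fun hx y
      rw [toLinearMap₂'_apply', hvec, transpose_transpose, LinearMap.zero_apply] at h
      rw [J_transpose, neg_mulVec, neg_dotProduct, dotProduct_comm, h, neg_zero])
    (fun x y => by rw [toLinearMap₂'_apply', toLinearMap₂'_apply', hvec, hsymm])
    (fun x => by
      rw [toLinearMap₂'_apply']
      simpa using hα.dotProduct_mulVec_nonneg x)
  simp only [toLinearMap₂'_apply'] at h1 h2 h3 h4 h5 h6
  let b : Fin n ⊕ Fin n → Fin n ⊕ Fin n → ℝ := Sum.elim e f
  have hmul (M : Matrix (Fin n ⊕ Fin n) (Fin n ⊕ Fin n) ℝ) (i j) :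
      ((of b)ᵀᵀ * M * (of b)ᵀ) i j = b i ⬝ᵥ M *ᵥ b j := by
    rw [Matrix.mul_assoc, transpose_transpose]
    rfl
  have hJ : (of b)ᵀᵀ * (J (Fin n) ℝ)ᵀ * (of b)ᵀ = (J (Fin n) ℝ)ᵀ := by
    ext i j
    rw [hmul]
    rcases i with i | i <;> rcases j with j | j
    · exact (h1 i j).trans (by simp [J])
    · exact (h3 i j).trans (by simp [J, one_apply, eq_comm])
    · have h := hvec (J (Fin n) ℝ)ᵀ (e j) (f i)
      rw [h3, transpose_transpose] at h
      change f i ⬝ᵥ (J (Fin n) ℝ)ᵀ *ᵥ e j = _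
      rw [J_transpose, neg_mulVec, dotProduct_neg, ← h]
      simp [J, one_apply, eq_comm]
    · exact (h2 i j).trans (by simp [J])
  refine ⟨(of b)ᵀ, ?_, fun i => b i ⬝ᵥ α *ᵥ b i, ?_⟩
  · rw [SymplecticGroup.mem_iff']
    simpa [J_transpose] using hJ
  · ext i j
    rw [hmul]
    rcases eq_or_ne i j with rfl | hij
    · rw [diagonal_apply_eq]
    · rw [diagonal_apply_ne _ hij]
      rcases i with i | i <;> rcases j with j | j
      · exact h5 i j fun h => hij (by rw [h])
      · exact h4 i j
      · rw [hvec, hsymm]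
        exact h4 j i
      · exact h6 i j fun h => hij (by rw [h])

theorem IsBosonicGaussianChannel.posSemidef {n : ℕ}
    {K α : Matrix (Fin n ⊕ Fin n) (Fin n ⊕ Fin n) ℝ} {l : (Fin n ⊕ Fin n) → ℝ}
    (h : IsBosonicGaussianChannel n K l α) : α.PosSemidef := by
  refine .of_dotProduct_mulVec_nonneg (by simpa [IsHermitian] using h.1) fun x => ?_
  have h2 := (Complex.nonneg_iff.1 (h.2.dotProduct_mulVec_nonneg fun i => (x i : ℂ))).1
  refine h2.trans_eq (Eq.symm ?_)
  have him (a b : ℝ) : (Complex.I / 2 * ((a : ℂ) - b)).re = 0 := by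
    rw [← Complex.ofReal_sub, Complex.re_mul_ofReal]
    simp
  simp only [dotProduct, mulVec, Complex.re_sum, Pi.star_apply, star_trivial, Matrix.sub_apply,
    Matrix.smul_apply, Matrix.map_apply, smul_eq_mul, RCLike.star_def, Complex.conj_ofReal,
    Complex.re_ofReal_mul, Complex.re_mul_ofReal, Complex.sub_re, Complex.ofReal_re, him, sub_zero]

theorem Matrix.transpose_aeval_mul_of_transpose_mul_eq_neg {ι : Type*} [Fintype ι] [DecidableEq ι]
    {W J : Matrix ι ι ℝ} (hJ : Jᵀ = -J) (hW : (W * J)ᵀ = -(W * J)) (p : Polynomial ℝ) :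
    (Polynomial.aeval W p * J)ᵀ = -(Polynomial.aeval W p * J) := by
  have hc : J * Wᵀ = W * J := by
    have h := hW
    rw [transpose_mul, hJ, Matrix.neg_mul] at h
    exact neg_inj.1 h
  have hpow (k : ℕ) : J * (W ^ k)ᵀ = W ^ k * J := by
    induction k with
    | zero => simp
    | succ k ih =>
      rw [pow_succ', transpose_mul, ← Matrix.mul_assoc, ih, Matrix.mul_assoc, hc,
        ← Matrix.mul_assoc, ← pow_succ, pow_succ']
  have hp : J * (Polynomial.aeval W p)ᵀ = Polynomial.aeval W p * J := by
    induction p using Polynomial.induction_on' with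
    | add p q hp hq => simp only [map_add, transpose_add, Matrix.mul_add, Matrix.add_mul, hp, hq]
    | monomial k a =>
      rw [Polynomial.aeval_monomial, ← Algebra.smul_def, transpose_smul, Matrix.mul_smul, hpow,
        Matrix.smul_mul]
  rw [transpose_mul, hJ, Matrix.neg_mul, hp]

/-- If `-Mᵀ * J * M * J` is invertible without negative eigenvalues, then `M` is the product of a
symplectic matrix and a skew-symmetric one. -/
theorem Matrix.exists_symplectic_mul_transpose_eq_neg {n : ℕ}
    {M : Matrix (Fin n ⊕ Fin n) (Fin n ⊕ Fin n) ℝ} (hM : M.det ≠ 0)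
    (h : ∀ t : ℝ, t < 0 → t ∉ spectrum ℝ (-(Mᵀ * J (Fin n) ℝ * M * J (Fin n) ℝ))) :
    ∃ S ∈ symplecticGroup (Fin n) ℝ, (S * M)ᵀ = -(S * M) := by
  set J := J (Fin n) ℝ with hJdef
  have hJt : Jᵀ = -J := J_transpose _ _
  have hJJ : J * J = -1 := J_squared _ _
  have hJdet : IsUnit J.det := isUnit_det_J _ _
  set W := -(Mᵀ * J * M * J) with hWdef
  have hMu : IsUnit M.det := hM.isUnit
  have hWdet : IsUnit W := by
    rw [hWdef, IsUnit.neg_iff, isUnit_iff_isUnit_det]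
    simp only [det_mul, det_transpose]
    exact ((hMu.mul hJdet).mul hMu).mul hJdet
  obtain ⟨p, hp⟩ := W.exists_aeval_sq_eq fun t ht => by
    rcases ht.lt_or_eq with ht | rfl
    · exact h t ht
    · exact spectrum.zero_notMem ℝ hWdet
  have hWJ : W * J = Mᵀ * J * M := by
    rw [hWdef, Matrix.neg_mul, Matrix.mul_assoc _ J J, hJJ, Matrix.mul_neg, neg_neg, Matrix.mul_one]
  set A := Polynomial.aeval W p * J with hAdef
  have hA : Aᵀ = -A := transpose_aeval_mul_of_transpose_mul_eq_neg hJt (by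
    rw [hWJ]
    simp only [transpose_mul, transpose_transpose, hJt, Matrix.mul_neg, Matrix.neg_mul,
      Matrix.mul_assoc]) p
  have hAJ : A * J = -Polynomial.aeval W p := by
    rw [hAdef, Matrix.mul_assoc, hJJ, Matrix.mul_neg, Matrix.mul_one]
  have hAJA : A * J * A = -(Mᵀ * J * M) := by
    rw [hAJ, hAdef, Matrix.neg_mul, ← Matrix.mul_assoc, ← sq, hp, hWJ]
  refine ⟨A * M⁻¹, ?_, ?_⟩
  · rw [SymplecticGroup.mem_iff']
    rw [transpose_mul, hA, transpose_nonsing_inv]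
    have e : Mᵀ⁻¹ * -A * J * (A * M⁻¹) = -(Mᵀ⁻¹ * (A * J * A) * M⁻¹) := by
      simp only [Matrix.mul_neg, Matrix.neg_mul, Matrix.mul_assoc]
    have hMt : IsUnit Mᵀ.det := by rwa [det_transpose]
    change Mᵀ⁻¹ * -A * J * (A * M⁻¹) = J
    rw [e, hAJA, Matrix.mul_neg, Matrix.neg_mul, neg_neg, Matrix.mul_assoc Mᵀ,
      nonsing_inv_mul_cancel_left _ _ hMt, mul_nonsing_inv_cancel_right _ _ hMu]
  · rw [nonsing_inv_mul_cancel_right _ _ hMu, hA]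

/-- A bosonic Gaussian channel `(K, l, α)` with `det K ≠ 0` such that `-Kᵀ·J·K·J` has no
negative real eigenvalues can be brought by inhomogeneous symplectic transformations to the
form `(A, 0, Λ)` with `A` skew-symmetric and `Λ` diagonal. -/
theorem stmt_16 (n : ℕ) (K α : Matrix (Fin n ⊕ Fin n) (Fin n ⊕ Fin n) ℝ)
    (l : (Fin n ⊕ Fin n) → ℝ)
    (hgauss : IsBosonicGaussianChannel n K l α) (hK : K.det ≠ 0)
    (heig : ∀ t : ℝ, t < 0 → t ∉ spectrum ℝ (-(Kᵀ * symplJ n * K * symplJ n))) :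
    ∃ S₁ S₂ : Matrix (Fin n ⊕ Fin n) (Fin n ⊕ Fin n) ℝ,
      ∃ h₁ h₂ : (Fin n ⊕ Fin n) → ℝ,
        ∃ A Λ : Matrix (Fin n ⊕ Fin n) (Fin n ⊕ Fin n) ℝ,
          S₁ * symplJ n * S₁ᵀ = symplJ n ∧ S₂ * symplJ n * S₂ᵀ = symplJ n ∧
          Aᵀ = -A ∧ (∃ d : (Fin n ⊕ Fin n) → ℝ, Λ = Matrix.diagonal d) ∧
          S₁ * K * S₂ = A ∧
          S₂ᵀ *ᵥ (Kᵀ *ᵥ h₁) + S₂ᵀ *ᵥ l + h₂ = 0 ∧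
          S₂ᵀ * α * S₂ = Λ := by
  obtain ⟨S, hS, d, hd⟩ := hgauss.posSemidef.exists_symplectic_diagonal
  have hSdet : IsUnit S.det := SymplecticGroup.symplectic_det hS
  have hSJ : S * symplJ n * Sᵀ = symplJ n := SymplecticGroup.mem_iff.1 hS
  have hconj : -((K * S)ᵀ * symplJ n * (K * S) * symplJ n) =
      Sᵀ * -(Kᵀ * symplJ n * K * symplJ n) * Sᵀ⁻¹ := by
    have hSt : IsUnit Sᵀ.det := by rwa [det_transpose]
    have h : S * symplJ n = symplJ n * Sᵀ⁻¹ := by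
      conv_rhs => rw [← hSJ]
      rw [mul_nonsing_inv_cancel_right _ _ hSt]
    rw [transpose_mul, Matrix.mul_neg, Matrix.neg_mul, neg_inj]
    simp only [Matrix.mul_assoc, h]
  obtain ⟨T, hT, hskew⟩ := Matrix.exists_symplectic_mul_transpose_eq_neg (M := K * S)
    (by rw [det_mul]; exact mul_ne_zero hK hSdet.ne_zero) (fun t ht hmem => heig t ht <| by
      change t ∈ spectrum ℝ (-((K * S)ᵀ * symplJ n * (K * S) * symplJ n)) at hmem
      have hSt : IsUnit Sᵀ := by rwa [isUnit_iff_isUnit_det, det_transpose]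
      obtain ⟨u, hu⟩ := hSt
      rw [hconj, ← hu, ← coe_units_inv, spectrum.units_conjugate] at hmem
      exact hmem)
  refine ⟨T, S, 0, -(Sᵀ *ᵥ l), T * K * S, diagonal d, SymplecticGroup.mem_iff.1 hT, hSJ, ?_,
    ⟨d, rfl⟩, rfl, by simp, hd⟩
  rw [Matrix.mul_assoc, hskew]
end

section
/- Let (K, l, α) be a bosonic Gaussian channel with det K ≠ 0 such that the matrix -Kᵀ·J·K·J has no positive real eigenvalues. Then there exist real symplectic matrices S₁ and S₂ (Sᵢ·J·Sᵢᵀ = J), vectors h₁, h₂ ∈ ℝ^{2n}, a real skew-symmetric matrix A (Aᵀ = -A), and a real diagonal matrix Λ such that S₁·K·S₂ = D·A, S₂ᵀ·Kᵀ·h₁ + S₂ᵀ·l + h₂ = 0, and S₂ᵀ·α·S₂ = Λ, where D is the block diagonal matrix D = [[Iₙ, 0], [0, -Iₙ]]. Equivalently, the channel (K, l, α) is transformed by inhomogeneous symplectic transformations into the channel (D·A, 0, Λ). -/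
open Matrix
open scoped ComplexOrder

/-- In a finite-dimensional commutative real algebra, an element without nonpositive real
eigenvalues is a square. -/
theorem isSquare_of_spectrum {S : Type*} [CommRing S] [Algebra ℝ S] [FiniteDimensional ℝ S]
    (x : S) (hx : ∀ t : ℝ, t ≤ 0 → t ∉ spectrum ℝ x) : IsSquare x := by
  have : IsArtinianRing S := IsArtinianRing.of_finite ℝ S
  have hxu : IsUnit x := by
    simpa [spectrum.zero_notMem_iff] using hx 0 le_rfl
  have hloc (I : MaximalSpectrum S) : ∃ y : S, y ^ 2 - x ∈ I.asIdeal := by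
    have := I.isMaximal
    let _ : Field (S ⧸ I.asIdeal) := Ideal.Quotient.field _
    have : FiniteDimensional ℝ (S ⧸ I.asIdeal) :=
      Module.Finite.of_surjective (Ideal.Quotient.mkₐ ℝ I.asIdeal).toLinearMap
        (Ideal.Quotient.mkₐ_surjective ℝ I.asIdeal)
    have hsq : IsSquare (Ideal.Quotient.mkₐ ℝ I.asIdeal x) := by
      obtain ⟨⟨e⟩⟩ | ⟨⟨e⟩⟩ := Real.nonempty_algEquiv_or (S ⧸ I.asIdeal)
      · have hpos : 0 ≤ e (Ideal.Quotient.mkₐ ℝ I.asIdeal x) := by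
          by_contra! h
          refine hx _ h.le ?_
          refine AlgHom.spectrum_apply_subset
            (e.toAlgHom.comp (Ideal.Quotient.mkₐ ℝ I.asIdeal)) x ?_
          have h0 : algebraMap ℝ (S ⧸ I.asIdeal) (e (Ideal.Quotient.mk I.asIdeal x)) =
              Ideal.Quotient.mk I.asIdeal x :=
            e.injective (by simp)
          simp [spectrum.mem_iff, h0]
        have := (Real.isSquare_iff.2 hpos).map e.symm
        simpa using this
      · obtain ⟨c, hc⟩ := IsAlgClosed.exists_pow_nat_eq
          (e (Ideal.Quotient.mkₐ ℝ I.asIdeal x)) two_pos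
        exact ⟨e.symm c, e.injective (by rw [← hc, map_mul, e.apply_symm_apply, pow_two])⟩
    obtain ⟨z, hz⟩ := hsq
    obtain ⟨y, rfl⟩ := Ideal.Quotient.mk_surjective z
    refine ⟨y, ?_⟩
    rw [← Ideal.Quotient.eq, map_pow, pow_two]
    exact hz.symm
  choose y hy using hloc
  obtain ⟨q, hq⟩ := Ideal.pi_quotient_surjective (I := fun I : MaximalSpectrum S => I.asIdeal)
    (fun I J hIJ => Ideal.isCoprime_of_isMaximal (fun h => hIJ (MaximalSpectrum.ext h)))
    (fun I => Ideal.Quotient.mk _ (y I))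
  have hnil : IsNilpotent (q ^ 2 - x) := by
    rw [← mem_nilradical, IsArtinianRing.nilradical_eq_iInf, Ideal.mem_iInf]
    intro I
    rw [← Ideal.Quotient.eq, map_pow, hq I, ← map_pow, Ideal.Quotient.eq]
    exact hy I
  have hqu : IsUnit q := by
    have : IsUnit (q ^ 2) := by
      simpa using hnil.isUnit_add_right_of_commute hxu (Commute.all _ _)
    exact (isUnit_pow_iff two_ne_zero).1 this
  obtain ⟨r, ⟨-, hr⟩, -⟩ := Polynomial.existsUnique_nilpotent_sub_and_aeval_eq_zero
    (R := S) (S := S) (P := Polynomial.X ^ 2 - Polynomial.C x) (x := q) (by simpa using hnil)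
    (by
      have h2 : IsUnit (2 : S) := by
        simpa only [map_ofNat] using (IsUnit.mk0 (2 : ℝ) two_ne_zero).map (algebraMap ℝ S)
      simpa [one_add_one_eq_two] using And.intro h2 hqu)
  exact ⟨r, by simpa [sub_eq_zero, pow_two, eq_comm] using hr⟩

open scoped InnerProductSpace in
/-- An injective skew-adjoint operator on a real inner product space splits orthogonally into
scaled rotations of planes. -/
theorem exists_orthonormal_skew_pairs (m : ℕ) : ∀ {V : Type} [NormedAddCommGroup V]
    [InnerProductSpace ℝ V] [FiniteDimensional ℝ V], Module.finrank ℝ V = 2 * m →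
    ∀ T : V →ₗ[ℝ] V, (∀ x y, ⟪T x, y⟫_ℝ = -⟪x, T y⟫_ℝ) → Function.Injective T →
    ∃ (e f : Fin m → V) (d : Fin m → ℝ), Orthonormal ℝ (Sum.elim e f) ∧ (∀ i, 0 < d i) ∧
      (∀ i, T (e i) = d i • f i) ∧ ∀ i, T (f i) = -(d i • e i) := by
  induction m with
  | zero =>
    intro V _ _ _ _ T _ _
    exact ⟨Fin.elim0, Fin.elim0, Fin.elim0,
      ⟨by simp, fun i => by rcases i with i | i <;> exact i.elim0⟩, fun i => i.elim0, fun i => i.elim0, fun i => i.elim0⟩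
  | succ m ih =>
    intro V _ _ _ hV T hT hinj
    have : Nontrivial V := Module.nontrivial_of_finrank_pos (R := ℝ) (by omega)
    have hsym : (T ∘ₗ T).IsSymmetric := fun x y => by simp [hT]
    obtain ⟨e, he⟩ := hsym.hasEigenvalue_iSup_of_finiteDimensional.exists_hasEigenvector
    obtain ⟨μ, e, he0, he⟩ : ∃ (μ : ℝ) (e : V), ‖e‖ = 1 ∧ T (T e) = μ • e := by
      have h := he.apply_eq_smul
      simp only [LinearMap.comp_apply] at h
      exact ⟨_, ‖e‖⁻¹ • e, by simp [norm_smul, he.2],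
        by rw [map_smul, map_smul, h, smul_comm]⟩
    have hd : 0 < ‖T e‖ := by
      rw [norm_pos_iff, ne_eq, map_eq_zero_iff T hinj]
      rintro rfl; simp at he0
    set d := ‖T e‖ with hddef
    have hee : ⟪e, e⟫_ℝ = 1 := by simp [he0]
    have hμ : μ = -(d * d) := by
      have := hT (T e) e
      rw [he, inner_smul_left, hee, real_inner_self_eq_norm_mul_norm] at this
      simpa using this
    obtain ⟨f, hf⟩ : ∃ f, f = d⁻¹ • T e := ⟨_, rfl⟩
    have hTe : T e = d • f := by rw [hf, smul_inv_smul₀ hd.ne']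
    have hTf : T f = -(d • e) := by
      rw [hf, map_smul, he, hμ, smul_smul, ← neg_smul]; congr 1; field_simp
    have hff : ⟪f, f⟫_ℝ = 1 := by
      rw [hf, inner_smul_left, inner_smul_right, real_inner_self_eq_norm_mul_norm, ← hddef]
      simp; field_simp
    have hef : ⟪e, f⟫_ℝ = 0 := by
      have := hT e e
      rw [real_inner_comm] at this
      rw [hf, inner_smul_right]
      have : ⟪e, T e⟫_ℝ = 0 := by linarith
      simp [this]
    have hfe : ⟪f, e⟫_ℝ = 0 := by rw [real_inner_comm]; exact hef
    have hon : Orthonormal ℝ ![e, f] := by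
      rw [orthonormal_iff_ite]
      intro i j
      fin_cases i <;> fin_cases j <;> simp [-inner_self_eq_norm_sq_to_K, hff, hef, hfe, hee]
    set U := Submodule.span ℝ (Set.range ![e, f])
    have hU : Module.finrank ℝ U = 2 := by
      simpa using finrank_span_eq_card hon.linearIndependent
    have hW : Module.finrank ℝ Uᗮ = 2 * m := by
      have := U.finrank_add_finrank_orthogonal
      omega
    have hmem (w : V) : w ∈ Uᗮ ↔ ⟪e, w⟫_ℝ = 0 ∧ ⟪f, w⟫_ℝ = 0 := by
      rw [Submodule.mem_orthogonal]
      constructor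
      · intro h
        exact ⟨h e (Submodule.subset_span ⟨0, rfl⟩), h f (Submodule.subset_span ⟨1, rfl⟩)⟩
      · rintro ⟨h1, h2⟩ u hu
        induction hu using Submodule.span_induction with
        | mem x hx => obtain ⟨i, rfl⟩ := hx; fin_cases i <;> simpa
        | zero => simp
        | add x y _ _ hx hy => simp [inner_add_left, hx, hy]
        | smul a x _ hx => simp [inner_smul_left, hx]
    have hinv : ∀ w ∈ Uᗮ, T w ∈ Uᗮ := by
      intro w hw
      rw [hmem] at hw ⊢
      have h1 := hT e w
      have h2 := hT f w
      rw [hTe, inner_smul_left, hw.2] at h1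
      rw [hTf, inner_neg_left, inner_smul_left, hw.1] at h2
      exact ⟨by simpa using h1.symm, by simpa using h2.symm⟩
    obtain ⟨e', f', d', hon', hd', hTe', hTf'⟩ := ih hW (T.restrict hinv)
      (fun x y => by simpa using hT x y)
      (fun x y h => Subtype.ext (hinj (by simpa using congrArg Subtype.val h)))
    refine ⟨Fin.cons e (fun i => e' i), Fin.cons f (fun i => f' i), Fin.cons d d', ?_, ?_, ?_, ?_⟩
    · rw [orthonormal_iff_ite] at hon' ⊢
      have he' i := (hmem _).1 (e' i).2
      have hf' i := (hmem _).1 (f' i).2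
      have he'' i : ⟪(e' i : V), e⟫_ℝ = 0 ∧ ⟪(e' i : V), f⟫_ℝ = 0 := by
        rw [real_inner_comm, real_inner_comm f]; exact he' i
      have hf'' i : ⟪(f' i : V), e⟫_ℝ = 0 ∧ ⟪(f' i : V), f⟫_ℝ = 0 := by
        rw [real_inner_comm, real_inner_comm f]; exact hf' i
      have h1 i j := hon' (.inl i) (.inl j)
      have h2 i j := hon' (.inl i) (.inr j)
      have h3 i j := hon' (.inr i) (.inl j)
      have h4 i j := hon' (.inr i) (.inr j)
      simp only [Sum.elim_inl, Sum.elim_inr, Submodule.coe_inner, Sum.inl.injEq, Sum.inr.injEq,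
        reduceCtorEq, if_false] at h1 h2 h3 h4
      rintro (i | i) (j | j) <;> refine Fin.cases ?_ (fun i => ?_) i <;>
        refine Fin.cases ?_ (fun j => ?_) j <;>
        simp [-inner_self_eq_norm_sq_to_K, h1, h2, h3, h4, hee, hef,
          hfe, hff, he', hf', he'', hf'', Fin.succ_ne_zero, (Fin.succ_ne_zero _).symm]
    · exact Fin.cases hd hd'
    · exact Fin.cases hTe fun i => by simpa using congrArg Subtype.val (hTe' i)
    · exact Fin.cases hTf fun i => by simpa using congrArg Subtype.val (hTf' i)

theorem symplJ_mul_self (n : ℕ) : symplJ n * symplJ n = -1 := J_squared _ _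

theorem symplJ_transpose (n : ℕ) : (symplJ n)ᵀ = -symplJ n := J_transpose _ _

theorem symplectic_of_transpose {n : ℕ} {S : Matrix (Fin n ⊕ Fin n) (Fin n ⊕ Fin n) ℝ}
    (h : Sᵀ * symplJ n * S = symplJ n) : S * symplJ n * Sᵀ = symplJ n :=
  SymplecticGroup.mem_iff.1 (SymplecticGroup.mem_iff'.2 h)

open scoped MatrixOrder in
theorem Matrix.PosDef.exists_eq_transpose_mul_self {ι : Type*} [Fintype ι] [DecidableEq ι]
    {α : Matrix ι ι ℝ} (hα : α.PosDef) : ∃ R : Matrix ι ι ℝ, IsUnit R.det ∧ α = Rᵀ * R := by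
  obtain ⟨R, hR⟩ := CStarAlgebra.nonneg_iff_eq_star_mul_self.mp hα.posSemidef.nonneg
  rw [star_eq_conjTranspose, conjTranspose_eq_transpose_of_trivial] at hR
  refine ⟨R, ?_, hR⟩
  have := hα.det_pos
  rw [hR, det_mul] at this
  exact (right_ne_zero_of_mul this.ne').isUnit

/-- Orthogonal normal form of a nonsingular skew-symmetric real matrix. -/
theorem exists_orthogonal_normal_form {n : ℕ} (B : Matrix (Fin n ⊕ Fin n) (Fin n ⊕ Fin n) ℝ)
    (hB : Bᵀ = -B) (hdet : IsUnit B.det) :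
    ∃ (O : Matrix (Fin n ⊕ Fin n) (Fin n ⊕ Fin n) ℝ) (d : Fin n → ℝ), (∀ i, 0 < d i) ∧
      Oᵀ * O = 1 ∧ B * O = O * fromBlocks 0 (-diagonal d) (diagonal d) 0 := by
  have hinj : Function.Injective (toEuclideanLin B) := by
    intro x y hxy
    have h := congrArg WithLp.ofLp hxy
    simp only [ofLp_toLpLin, toLin'_apply] at h
    exact WithLp.ofLp_injective 2 (mulVec_injective_of_isUnit ((isUnit_iff_isUnit_det B).2 hdet) h)
  have hskew (x y : EuclideanSpace ℝ (Fin n ⊕ Fin n)) :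
      inner ℝ (toEuclideanLin B x) y = -inner ℝ x (toEuclideanLin B y) := by
    simp only [EuclideanSpace.inner_eq_star_dotProduct, ofLp_toLpLin, toLin'_apply, star_trivial]
    rw [dotProduct_mulVec, ← mulVec_transpose, hB, neg_mulVec, neg_dotProduct]
  obtain ⟨e, f, d, hon, hd, he, hf⟩ := exists_orthonormal_skew_pairs n
    (by rw [finrank_euclideanSpace, Fintype.card_sum, Fintype.card_fin, two_mul])
    (toEuclideanLin B) hskew hinj
  refine ⟨of fun i j => Sum.elim e f j i, d, hd, ?_, ?_⟩
  · ext i j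
    have := orthonormal_iff_ite.1 hon i j
    rw [EuclideanSpace.inner_eq_star_dotProduct] at this
    rw [mul_apply, one_apply, ← this]
    simp [dotProduct, mul_comm]
  · ext i (j | j)
    · have := congrArg (fun v : EuclideanSpace ℝ (Fin n ⊕ Fin n) => v i) (he j)
      simp [mulVec, dotProduct, toLpLin_apply] at this
      simp [mul_apply, this, diagonal_apply, mul_comm]
    · have := congrArg (fun v : EuclideanSpace ℝ (Fin n ⊕ Fin n) => v i) (hf j)
      simp [mulVec, dotProduct, toLpLin_apply] at this
      simp [mul_apply, this, diagonal_apply, mul_comm]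

/-- **Williamson's theorem**: a positive definite real matrix is symplectically diagonalizable. -/
theorem williamson {n : ℕ} {α : Matrix (Fin n ⊕ Fin n) (Fin n ⊕ Fin n) ℝ} (hα : α.PosDef) :
    ∃ (S : Matrix (Fin n ⊕ Fin n) (Fin n ⊕ Fin n) ℝ) (d : (Fin n ⊕ Fin n) → ℝ),
      Sᵀ * symplJ n * S = symplJ n ∧ Sᵀ * α * S = diagonal d := by
  obtain ⟨R, hR, rfl⟩ := hα.exists_eq_transpose_mul_self
  obtain ⟨O, d, hd, hO, hBO⟩ := exists_orthogonal_normal_form (R⁻¹ᵀ * symplJ n * R⁻¹)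
    (by simp [symplJ_transpose, mul_assoc])
    (by
      rw [det_mul, det_mul, det_transpose]
      exact ((isUnit_nonsing_inv_det R hR).mul (isUnit_det_J _ _)).mul
        (isUnit_nonsing_inv_det R hR))
  set s : Fin n → ℝ := fun i => (√(d i))⁻¹
  have hs i : s i * d i * s i = 1 := by
    have h1 := Real.sqrt_pos.2 (hd i)
    have h2 := Real.mul_self_sqrt (hd i).le
    simp only [s]
    field_simp
    nlinarith
  set E : Matrix (Fin n ⊕ Fin n) (Fin n ⊕ Fin n) ℝ :=
    fromBlocks (diagonal s) 0 0 (diagonal s) with hE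
  have hEt : Eᵀ = E := by simp [hE]
  refine ⟨R⁻¹ * O * E, Sum.elim (fun i => s i * s i) (fun i => s i * s i), ?_, ?_⟩
  · calc (R⁻¹ * O * E)ᵀ * symplJ n * (R⁻¹ * O * E)
        = E * Oᵀ * (R⁻¹ᵀ * symplJ n * R⁻¹ * O) * E := by
          simp only [transpose_mul, hEt, mul_assoc]
      _ = E * (Oᵀ * O) * fromBlocks 0 (-diagonal d) (diagonal d) 0 * E := by
          rw [hBO]; simp only [mul_assoc]
      _ = symplJ n := by
          rw [hO, mul_one]
          simp only [hE, symplJ, fromBlocks_multiply, zero_mul, mul_zero, add_zero, zero_add,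
            neg_mul, mul_neg, diagonal_mul_diagonal, hs, diagonal_one, neg_zero]
  · calc (R⁻¹ * O * E)ᵀ * (Rᵀ * R) * (R⁻¹ * O * E)
        = E * Oᵀ * ((R * R⁻¹)ᵀ * (R * R⁻¹)) * O * E := by
          simp only [transpose_mul, hEt, mul_assoc]
      _ = E * (Oᵀ * O) * E := by
          rw [mul_nonsing_inv R hR]; simp [mul_assoc]
      _ = _ := by
          rw [hO, mul_one]
          simp [hE, diagonal_mul_diagonal]

theorem exists_sqrt_mem_adjoin {ι : Type*} [Fintype ι] [DecidableEq ι] (X : Matrix ι ι ℝ)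
    (hX : ∀ t : ℝ, t ≤ 0 → t ∉ spectrum ℝ X) : ∃ Y ∈ Algebra.adjoin ℝ {X}, Y * Y = X := by
  let x : Algebra.adjoin ℝ {X} := ⟨X, Algebra.self_mem_adjoin_singleton ℝ X⟩
  have : IsMulCommutative (Algebra.adjoin ℝ {X}) := Algebra.isMulCommutative_adjoin ℝ (by simp)
  have : IsArtinianRing (Algebra.adjoin ℝ {X}) := IsArtinianRing.of_finite ℝ _
  obtain ⟨y, hy⟩ := isSquare_of_spectrum x fun t ht => by
    have h := hX t ht
    rw [spectrum.notMem_iff] at h ⊢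
    refine IsArtinianRing.isUnit_of_mem_nonZeroDivisors (mem_nonZeroDivisors_iff_right.2 ?_)
    intro z hz
    exact Subtype.ext ((h.mul_left_eq_zero).1 (congrArg Subtype.val hz))
  exact ⟨y, y.2, (congrArg Subtype.val hy).symm⟩

theorem exists_skew_sqrt {n : ℕ} (N : Matrix (Fin n ⊕ Fin n) (Fin n ⊕ Fin n) ℝ) (hN : Nᵀ = -N)
    (hspec : ∀ t : ℝ, t ≤ 0 → t ∉ spectrum ℝ (N * symplJ n)) :
    ∃ A, Aᵀ = -A ∧ A * symplJ n * A = N := by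
  obtain ⟨Y, hYmem, hY⟩ := exists_sqrt_mem_adjoin _ hspec
  have hJ := symplJ_mul_self n
  have hcomm : SemiconjBy (symplJ n) Yᵀ Y := by
    clear hY
    induction hYmem using Algebra.adjoin_induction with
    | mem x hx =>
      rw [Set.mem_singleton_iff.1 hx, SemiconjBy, transpose_mul, hN, symplJ_transpose, neg_mul_neg,
        ← mul_assoc, hJ, mul_assoc, hJ, neg_one_mul, mul_neg_one]
    | algebraMap r =>
      rw [Algebra.algebraMap_eq_smul_one, transpose_smul, transpose_one]
      simp [SemiconjBy]
    | add x y _ _ hx hy => rw [transpose_add]; exact hx.add_right hy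
    | mul x y hxm hym hx hy =>
      rw [transpose_mul, (Algebra.commute_of_mem_adjoin_singleton_of_commute hym
        (Algebra.commute_of_mem_adjoin_self hxm).symm).eq]
      exact hy.mul_right hx
  refine ⟨-(Y * symplJ n), ?_, ?_⟩
  · rw [transpose_neg, transpose_mul, symplJ_transpose, neg_mul, hcomm.eq]
  · calc -(Y * symplJ n) * symplJ n * -(Y * symplJ n)
        = Y * (symplJ n * symplJ n) * Y * symplJ n := by simp [mul_assoc]
      _ = -(Y * Y) * symplJ n := by simp [hJ]
      _ = N := by rw [hY, neg_mul, mul_assoc, hJ]; simp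

theorem IsBosonicGaussianChannel.posDef {n : ℕ}
    {K α : Matrix (Fin n ⊕ Fin n) (Fin n ⊕ Fin n) ℝ} {l : (Fin n ⊕ Fin n) → ℝ}
    (h : IsBosonicGaussianChannel n K l α)
    (heig : (1 : ℝ) ∉ spectrum ℝ (-(Kᵀ * symplJ n * K * symplJ n))) : α.PosDef := by
  obtain ⟨hα, hpos⟩ := h
  set M := symplJ n - Kᵀ * symplJ n * K with hM
  have hMt : Mᵀ = -M := by simp [hM, symplJ_transpose, mul_assoc, neg_add_eq_sub]
  have hmul (x : Fin n ⊕ Fin n → ℝ) :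
      (α.map Complex.ofReal - (Complex.I / 2) • ((symplJ n).map Complex.ofReal -
        (Kᵀ * symplJ n * K).map Complex.ofReal)) *ᵥ (fun i => (x i : ℂ)) =
      fun i => ((α *ᵥ x) i : ℂ) - Complex.I / 2 * ((M *ᵥ x) i : ℂ) := by
    have hmap (P : Matrix (Fin n ⊕ Fin n) (Fin n ⊕ Fin n) ℝ) :
        P.map Complex.ofReal *ᵥ (fun i => (x i : ℂ)) = fun i => ((P *ᵥ x) i : ℂ) := by
      ext i; simp [mulVec, dotProduct]
    rw [sub_mulVec, smul_mulVec, sub_mulVec, hmap, hmap, hmap, hM, sub_mulVec]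
    ext i
    simp
  have hMx (x : Fin n ⊕ Fin n → ℝ) : x ⬝ᵥ (M *ᵥ x) = 0 := by
    have : x ⬝ᵥ (M *ᵥ x) = -(x ⬝ᵥ (M *ᵥ x)) := by
      conv_lhs => rw [dotProduct_mulVec, ← mulVec_transpose, hMt, neg_mulVec, neg_dotProduct,
        dotProduct_comm]
    linarith
  have hquad (x : Fin n ⊕ Fin n → ℝ) : star (fun i => (x i : ℂ)) ⬝ᵥ
      (fun i => ((α *ᵥ x) i : ℂ) - Complex.I / 2 * ((M *ᵥ x) i : ℂ)) =
      ((x ⬝ᵥ (α *ᵥ x) : ℝ) : ℂ) := by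
    have h1 := congrArg (fun r : ℝ => Complex.I / 2 * (r : ℂ)) (hMx x)
    simp only [dotProduct, Complex.ofReal_sum, Complex.ofReal_mul, Finset.mul_sum,
      Complex.ofReal_zero, mul_zero] at h1 ⊢
    rw [← sub_zero (∑ i, (x i : ℂ) * ((α *ᵥ x) i : ℂ)), ← h1, ← Finset.sum_sub_distrib]
    refine Finset.sum_congr rfl fun i _ => ?_
    simp
    ring
  refine posDef_iff_dotProduct_mulVec.2 ⟨by simpa [IsHermitian] using hα, fun x hx => ?_⟩
  have h0 := hpos.dotProduct_mulVec_nonneg (fun i => (x i : ℂ))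
  have h1 := hpos.dotProduct_mulVec_zero_iff (fun i => (x i : ℂ))
  rw [hmul, hquad] at h0 h1
  rw [star_trivial]
  refine lt_of_le_of_ne (by exact_mod_cast h0) fun hzero => ?_
  have h2 := h1.1 (by rw [← hzero, Complex.ofReal_zero])
  have h3 : M *ᵥ x = 0 := by
    ext i
    have := congrArg Complex.im (congrFun h2 i)
    simpa using this
  rw [hM, sub_mulVec, sub_eq_zero] at h3
  refine heig ?_
  rw [← spectrum_toLin', ← Module.End.hasEigenvalue_iff_mem_spectrum]
  refine Module.End.hasEigenvalue_of_hasEigenvector (x := symplJ n *ᵥ x) ⟨?_, ?_⟩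
  · rw [Module.End.mem_eigenspace_iff]
    rw [toLin'_apply, one_smul, mulVec_mulVec, neg_mul, mul_assoc _ (symplJ n),
      symplJ_mul_self, mul_neg_one, neg_neg, h3]
  · intro hv
    have := congrArg (symplJ n *ᵥ ·) hv
    rw [mulVec_mulVec, symplJ_mul_self, mulVec_zero, neg_mulVec, one_mulVec, neg_eq_zero] at this
    exact hx this

/-- A bosonic Gaussian channel `(K, l, α)` with `det K ≠ 0` such that `-Kᵀ·J·K·J` has no
positive real eigenvalues can be brought by inhomogeneous symplectic transformations to the
form `(D·A, 0, Λ)` with `A` skew-symmetric and `Λ` diagonal. -/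
theorem stmt_17 (n : ℕ) (K α : Matrix (Fin n ⊕ Fin n) (Fin n ⊕ Fin n) ℝ)
    (l : (Fin n ⊕ Fin n) → ℝ)
    (hgauss : IsBosonicGaussianChannel n K l α) (hK : K.det ≠ 0)
    (heig : ∀ t : ℝ, t > 0 → t ∉ spectrum ℝ (-(Kᵀ * symplJ n * K * symplJ n))) :
    ∃ S₁ S₂ : Matrix (Fin n ⊕ Fin n) (Fin n ⊕ Fin n) ℝ,
      ∃ h₁ h₂ : (Fin n ⊕ Fin n) → ℝ,
        ∃ A Λ : Matrix (Fin n ⊕ Fin n) (Fin n ⊕ Fin n) ℝ,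
          S₁ * symplJ n * S₁ᵀ = symplJ n ∧ S₂ * symplJ n * S₂ᵀ = symplJ n ∧
          Aᵀ = -A ∧ (∃ d : (Fin n ⊕ Fin n) → ℝ, Λ = Matrix.diagonal d) ∧
          S₁ * K * S₂ = Dmat n * A ∧
          S₂ᵀ *ᵥ (Kᵀ *ᵥ h₁) + S₂ᵀ *ᵥ l + h₂ = 0 ∧
          S₂ᵀ * α * S₂ = Λ := by
  have h0 := hK.isUnit
  obtain ⟨S, d, hS, hSα⟩ := williamson (hgauss.posDef (heig 1 one_pos))
  have hS' := symplectic_of_transpose hS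
  have hSdet : IsUnit S.det :=
    SymplecticGroup.symplectic_det (SymplecticGroup.mem_iff.2 hS')
  have hJ := symplJ_mul_self n
  set L := K * S with hL
  have hLdet : IsUnit L.det := by rw [hL, det_mul]; exact h0.mul hSdet
  have hLtdet : IsUnit Lᵀ.det := by rwa [det_transpose]
  have hspec (t : ℝ) (ht : t ≤ 0) : t ∉ spectrum ℝ (Lᵀ * symplJ n * L * symplJ n) := by
    rcases ht.lt_or_eq with ht | rfl
    · intro hmem
      refine heig (-t) (by linarith) ?_
      have hSt : IsUnit Sᵀ := (isUnit_iff_isUnit_det _).2 (by rwa [det_transpose])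
      have hconj : Lᵀ * symplJ n * L * symplJ n * Sᵀ =
          Sᵀ * (Kᵀ * symplJ n * K * symplJ n) := by
        calc Lᵀ * symplJ n * L * symplJ n * Sᵀ
            = Sᵀ * (Kᵀ * symplJ n * K * (S * symplJ n * Sᵀ)) := by
              simp only [hL, transpose_mul, mul_assoc]
          _ = _ := by rw [hS']
      rw [spectrum.mem_iff] at hmem ⊢
      contrapose! hmem
      have hcomm : (algebraMap ℝ _ t - Lᵀ * symplJ n * L * symplJ n) * Sᵀ =
          Sᵀ * -(algebraMap ℝ _ (-t) - -(Kᵀ * symplJ n * K * symplJ n)) := by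
        rw [sub_mul, hconj, Algebra.commutes, ← mul_sub, map_neg]
        congr 1
        abel
      exact hSt.mul_right_iff.1 (by rw [hcomm]; exact hSt.mul hmem.neg)
    · rw [spectrum.zero_notMem_iff, isUnit_iff_isUnit_det, det_mul, det_mul, det_mul]
      exact ((hLtdet.mul (isUnit_det_J _ _)).mul hLdet).mul (isUnit_det_J _ _)
  obtain ⟨A, hA, hAN⟩ := exists_skew_sqrt (Lᵀ * symplJ n * L)
    (by simp [symplJ_transpose, mul_assoc]) hspec
  have hDJD : (Dmat n)ᵀ * symplJ n * Dmat n = -symplJ n := by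
    simp [Dmat, symplJ, fromBlocks_transpose, fromBlocks_multiply, fromBlocks_neg]
  refine ⟨Dmat n * A * L⁻¹, S, 0, -(Sᵀ *ᵥ l), A, diagonal d, symplectic_of_transpose ?_, hS', hA,
    ⟨d, rfl⟩, ?_, by simp, hSα⟩
  · calc (Dmat n * A * L⁻¹)ᵀ * symplJ n * (Dmat n * A * L⁻¹)
        = L⁻¹ᵀ * (Aᵀ * ((Dmat n)ᵀ * symplJ n * Dmat n) * A) * L⁻¹ := by
          simp only [transpose_mul, mul_assoc]
      _ = L⁻¹ᵀ * (A * symplJ n * A) * L⁻¹ := by rw [hDJD, hA]; simp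
      _ = (L * L⁻¹)ᵀ * symplJ n * (L * L⁻¹) := by
          rw [hAN]; simp only [transpose_mul, mul_assoc]
      _ = symplJ n := by rw [mul_nonsing_inv L hLdet]; simp
  · rw [mul_assoc, mul_assoc, ← hL, nonsing_inv_mul L hLdet, mul_one]
end
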